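/- Fix a finite state space S, a finite action space A, a reward function r : S × A → ℝ, a transition kernel p assigning to each (s,a) a probability distribution p(·|s,a) on S, a prior policy π₀ with π₀(a|s) > 0 for all (s,a), an inverse temperature β > 0, and a policy π. Suppose Q : S × A → ℝ and θ ∈ ℝ satisfy the entropy-regularized average-reward Bellman equation for π: Q(s,a) = r(s,a) − θ + E_{s'∼p(·|s,a)} V(s') for all (s,a), where V(s) = E_{a∼π(·|s)} [ Q(s,a) − β⁻¹ log(π(a|s)/π₀(a|s)) ]. Define the Boltzmann-improved policy π'(a|s) = π₀(a|s) e^{β Q(s,a)} / Σ_{b∈A} π₀(b|s) e^{β Q(s,b)}. Suppose d' is a stationary distribution for π', i.e. d'(s') = Σ_s d'(s) Σ_a π'(a|s) p(s'|s,a) for all s', and let θ' = E_{s∼d', a∼π'(·|s)} [ r(s,a) − β⁻¹ log(π'(a|s)/π₀(a|s)) ]. Then θ' ≥ θ (the improved policy achieves a greater or equal entropy-regularized reward-rate). -/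

import Mathlib

/-- **Gibbs variational inequality**: the log-partition function bounds the expectation of `x`
minus the relative entropy, for any probability vector `w`. -/
theorem sum_mul_sub_log_div_le_log_sum_exp {A : Type*} [Fintype A] [Nonempty A]
    {q w : A → ℝ} (hq : ∀ a, 0 < q a) (hw : ∀ a, 0 ≤ w a) (hw_sum : ∑ a, w a = 1) (x : A → ℝ) :
    ∑ a, w a * (x a - Real.log (w a / q a)) ≤ Real.log (∑ a, q a * Real.exp (x a)) := by
  set Z := ∑ a, q a * Real.exp (x a) with hZ
  have hZ_pos : 0 < Z :=
    Finset.sum_pos (fun a _ => mul_pos (hq a) (Real.exp_pos _)) Finset.univ_nonempty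
  have key : ∀ a, w a * (x a - Real.log (w a / q a)) - w a * Real.log Z
      ≤ q a * Real.exp (x a) / Z - w a := by
    intro a
    have hqa := hq a
    rcases (hw a).eq_or_lt with h | h
    · rw [← h]
      simp only [zero_mul, sub_zero]
      positivity
    · have hlog : Real.log (q a * Real.exp (x a) / Z / w a)
          = x a - Real.log (w a / q a) - Real.log Z := by
        rw [Real.log_div (by positivity) h.ne', Real.log_div (by positivity) hZ_pos.ne',
          Real.log_mul hqa.ne' (Real.exp_pos _).ne', Real.log_exp, Real.log_div h.ne' hqa.ne']
        ring
      have hle := Real.log_le_sub_one_of_pos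
        (show 0 < q a * Real.exp (x a) / Z / w a by positivity)
      rw [hlog] at hle
      calc _ = w a * (x a - Real.log (w a / q a) - Real.log Z) := by ring
        _ ≤ w a * (q a * Real.exp (x a) / Z / w a - 1) := mul_le_mul_of_nonneg_left hle h.le
        _ = _ := by field_simp
  have hsum := Finset.sum_le_sum fun a (_ : a ∈ Finset.univ) => key a
  rw [Finset.sum_sub_distrib, Finset.sum_sub_distrib, ← Finset.sum_mul, ← Finset.sum_div, hw_sum,
    ← hZ, div_self hZ_pos.ne'] at hsum
  linarith


/-- ERAR Policy Improvement: the Boltzmann-improved policy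
achieves a greater or equal entropy-regularized reward-rate. -/
theorem erar_policy_improvement
    {S A : Type} [Fintype S] [Fintype A] [Nonempty A]
    (r : S → A → ℝ)
    (p : S → A → S → ℝ)
    (hp_nonneg : ∀ s a s', 0 ≤ p s a s')
    (hp_sum : ∀ s a, ∑ s', p s a s' = 1)
    (π₀ : S → A → ℝ)
    (hπ₀_pos : ∀ s a, 0 < π₀ s a)
    (hπ₀_sum : ∀ s, ∑ a, π₀ s a = 1)
    (β : ℝ) (hβ : 0 < β)
    (π : S → A → ℝ)
    (hπ_nonneg : ∀ s a, 0 ≤ π s a)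
    (hπ_sum : ∀ s, ∑ a, π s a = 1)
    (Q : S → A → ℝ) (θ : ℝ)
    (V : S → ℝ)
    (hV : ∀ s, V s = ∑ a, π s a * (Q s a - β⁻¹ * Real.log (π s a / π₀ s a)))
    (hBellman : ∀ s a, Q s a = r s a - θ + ∑ s', p s a s' * V s')
    (π' : S → A → ℝ)
    (hπ' : ∀ s a, π' s a =
      π₀ s a * Real.exp (β * Q s a) / ∑ b, π₀ s b * Real.exp (β * Q s b))
    (d' : S → ℝ)
    (hd'_nonneg : ∀ s, 0 ≤ d' s)
    (hd'_sum : ∑ s, d' s = 1)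
    (hd'_stat : ∀ s', d' s' = ∑ s, d' s * ∑ a, π' s a * p s a s')
    (θ' : ℝ)
    (hθ' : θ' = ∑ s, d' s * ∑ a, π' s a *
      (r s a - β⁻¹ * Real.log (π' s a / π₀ s a))) :
    θ' ≥ θ := by
  let Z : S → ℝ := fun s => ∑ b, π₀ s b * Real.exp (β * Q s b)
  have hZ_pos : ∀ s, 0 < Z s := fun s =>
    Finset.sum_pos (fun b _ => mul_pos (hπ₀_pos s b) (Real.exp_pos _)) Finset.univ_nonempty
  have hπ'_sum : ∀ s, ∑ a, π' s a = 1 := fun s => by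
    simp only [hπ', ← Finset.sum_div]
    exact div_self (hZ_pos s).ne'
  have hV_le : ∀ s, V s ≤ β⁻¹ * Real.log (Z s) := fun s => by
    refine le_trans (le_of_eq ?_) (mul_le_mul_of_nonneg_left
      (sum_mul_sub_log_div_le_log_sum_exp (hπ₀_pos s) (hπ_nonneg s) (hπ_sum s)
        (fun a => β * Q s a)) (inv_pos.mpr hβ).le)
    rw [hV, Finset.mul_sum]
    refine Finset.sum_congr rfl fun a _ => ?_
    field_simp
  have hlog : ∀ s a, Real.log (π' s a / π₀ s a) = β * Q s a - Real.log (Z s) := fun s a => by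
    have h : π' s a / π₀ s a = Real.exp (β * Q s a) / Z s := by
      rw [hπ']
      have := (hπ₀_pos s a).ne'
      field_simp
      rfl
    rw [h, Real.log_div (Real.exp_pos _).ne' (hZ_pos s).ne', Real.log_exp]
  have hinner : ∀ s, ∑ a, π' s a * (r s a - β⁻¹ * Real.log (π' s a / π₀ s a))
      = θ + β⁻¹ * Real.log (Z s) - ∑ a, π' s a * ∑ s', p s a s' * V s' := fun s => by
    calc _ = ∑ a, (π' s a * (θ + β⁻¹ * Real.log (Z s)) - π' s a * ∑ s', p s a s' * V s') := by
          refine Finset.sum_congr rfl fun a _ => ?_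
          have hr : r s a = Q s a + θ - ∑ s', p s a s' * V s' := by linarith [hBellman s a]
          rw [hlog, hr]
          field_simp
          ring
      _ = _ := by rw [Finset.sum_sub_distrib, ← Finset.sum_mul, hπ'_sum, one_mul]
  have hstat : ∑ s, d' s * ∑ a, π' s a * ∑ s', p s a s' * V s' = ∑ s, d' s * V s := by
    have h : ∀ s', d' s' * V s' = ∑ s, ∑ a, d' s * (π' s a * (p s a s' * V s')) := fun s' => by
      conv_lhs => rw [hd'_stat s']
      simp only [Finset.sum_mul, Finset.mul_sum, mul_assoc]
    simp only [h, Finset.mul_sum]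
    conv_rhs => rw [Finset.sum_comm]
    refine Finset.sum_congr rfl fun s _ => ?_
    exact Finset.sum_comm
  have hθ'_eq : θ' = θ + ∑ s, d' s * (β⁻¹ * Real.log (Z s) - V s) := by
    rw [hθ']
    simp only [hinner]
    simp only [mul_sub, mul_add, Finset.sum_sub_distrib, Finset.sum_add_distrib, hstat,
      ← Finset.sum_mul, hd'_sum, one_mul]
    ring
  have := Finset.sum_nonneg fun s (_ : s ∈ Finset.univ) =>
    mul_nonneg (hd'_nonneg s) (sub_nonneg.mpr (hV_le s))
  linarith
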